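/- arXiv:1711.09656 — 2 statements merged into one kernel-verified Lean document; each statement's English description precedes it below -/
import Mathlib

section
/- (Triangle Condition.) Let G be a connected K_4-free bridged graph and let u, v, w be vertices such that v and w are adjacent and d(u,v) = d(u,w) ≥ 1. Then there exists a vertex x adjacent to both v and w with d(u,x) = d(u,v) − 1. -/
/-- A graph is `K_4`-free if it has no four pairwise adjacent vertices. -/
def K4Free {V : Type*} (G : SimpleGraph V) : Prop :=
  ¬ ∃ a b c d : V, G.Adj a b ∧ G.Adj a c ∧ G.Adj a d ∧ G.Adj b c ∧ G.Adj b d ∧ G.Adj c d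

/-- `f : ZMod n → V` is an isometric cycle of length `n` in `G`: an embedded cycle such
that the distance in `G` between any two of its vertices equals their distance along the
cycle, which is `min (i - j).val ((j - i).val)`. -/
def IsIsometricCycle {V : Type*} (G : SimpleGraph V) (n : ℕ) (f : ZMod n → V) : Prop :=
  3 ≤ n ∧ Function.Injective f ∧
    (∀ i : ZMod n, G.Adj (f i) (f (i + 1))) ∧
    (∀ i j : ZMod n, G.dist (f i) (f j) = min (i - j).val (j - i).val)

/-- A graph is bridged if every isometric cycle in it has length 3. -/
def Bridged {V : Type*} (G : SimpleGraph V) : Prop :=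
  ∀ (n : ℕ) (f : ZMod n → V), IsIsometricCycle G n f → n = 3

namespace SimpleGraph

variable {V : Type*} {G : SimpleGraph V}

/-- Any two neighbours of a vertex of height `j` which have height `j - 1` are equal or
adjacent. -/
def LowerNeighborsClique (G : SimpleGraph V) (h : V → ℕ) (j : ℕ) : Prop :=
  ∀ p a b : V, h p = j → G.Adj p a → G.Adj p b → h a + 1 = j → h b + 1 = j →
    a = b ∨ G.Adj a b

/-- The ends of any edge at height `j` have a common neighbour of height `j - 1`. -/
def EdgesDescend (G : SimpleGraph V) (h : V → ℕ) (j : ℕ) : Prop :=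
  ∀ v w : V, G.Adj v w → h v = j → h w = j → ∃ c, G.Adj v c ∧ G.Adj w c ∧ h c + 1 = j

theorem Connected.dist_le_dist_add_one (hc : G.Connected) (x : V) {a b : V} (hab : G.Adj a b) :
    G.dist x a ≤ G.dist x b + 1 := by
  have h1 := hc.dist_triangle (u := x) (v := b) (w := a)
  have h2 := SimpleGraph.dist_eq_one_iff_adj.2 hab.symm
  omega

theorem Connected.dist_le_dist_add_one' (hc : G.Connected) (x : V) {a b : V} (hab : G.Adj a b) :
    G.dist a x ≤ G.dist b x + 1 := by
  have := hc.dist_le_dist_add_one x hab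
  rwa [G.dist_comm (u := a), G.dist_comm (u := b)]

theorem Connected.exists_adj_dist_eq (hc : G.Connected) {a b : V} {n : ℕ}
    (h : G.dist a b = n + 1) : ∃ c, G.Adj a c ∧ G.dist c b = n := by
  obtain ⟨p, hp⟩ := hc.exists_walk_length_eq_dist a b
  cases p with
  | nil => simp at h
  | @cons _ c _ hac q =>
    refine ⟨c, hac, ?_⟩
    have h1 := SimpleGraph.dist_le q
    have h2 := hc.dist_le_dist_add_one' b hac
    simp only [SimpleGraph.Walk.length_cons] at hp
    omega

/-- `p` traverses a geodesic of length `n` from `a` to `b` in its first `n` steps. -/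
structure IsGeodesic (G : SimpleGraph V) (a b : V) (n : ℕ) (p : ℕ → V) : Prop where
  start : p 0 = a
  finish : p n = b
  adj : ∀ i < n, G.Adj (p i) (p (i + 1))
  dist_left : ∀ i ≤ n, G.dist a (p i) = i
  dist_right : ∀ i ≤ n, G.dist (p i) b + i = n

theorem Connected.isGeodesic_cons (hc : G.Connected) {a b c : V} {n : ℕ} {p : ℕ → V}
    (h : G.dist a b = n + 1) (hac : G.Adj a c) (hp : G.IsGeodesic c b n p) :
    G.IsGeodesic a b (n + 1) (fun i => if i = 0 then a else p (i - 1)) where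
  start := rfl
  finish := by simpa using hp.finish
  adj := by
    rintro (_ | i) hi
    · simpa [hp.start] using hac
    · simpa using hp.adj i (by omega)
  dist_left := by
    rintro (_ | i) hi
    · simp
    · have h1 := hp.dist_left i (by omega)
      have h2 := hp.dist_right i (by omega)
      have h3 := hc.dist_le_dist_add_one' (p i) hac
      have h4 := hc.dist_triangle (u := a) (v := p i) (w := b)
      simp only [Nat.add_eq_zero_iff, one_ne_zero, and_false, if_false, Nat.add_sub_cancel]
      omega
  dist_right := by
    rintro (_ | i) hi
    · simpa using h
    · have h2 := hp.dist_right i (by omega)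
      simp only [Nat.add_eq_zero_iff, one_ne_zero, and_false, if_false, Nat.add_sub_cancel]
      omega

theorem Connected.exists_isGeodesic (hc : G.Connected) {n : ℕ} :
    ∀ {a b : V}, G.dist a b = n → ∃ p, G.IsGeodesic a b n p := by
  induction n with
  | zero =>
    intro a b h
    obtain rfl := hc.dist_eq_zero_iff.1 h
    exact ⟨fun _ => a, rfl, rfl, by simp, by simp, by simp⟩
  | succ n ih =>
    intro a b h
    obtain ⟨c, hac, hcb⟩ := hc.exists_adj_dist_eq h
    obtain ⟨p, hp⟩ := ih hcb
    exact ⟨_, hc.isGeodesic_cons h hac hp⟩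

theorem Connected.exists_isGeodesic_through (hc : G.Connected) {a b c : V} {n : ℕ}
    (h : G.dist a b = n) (hac : G.Adj a c) (hcb : G.dist c b + 1 = n) :
    ∃ p, G.IsGeodesic a b n p ∧ ∀ i, 1 ≤ i → i ≤ n → G.dist c (p i) + 1 = i := by
  obtain ⟨p, hp⟩ := hc.exists_isGeodesic (a := c) (b := b) rfl
  subst hcb
  refine ⟨_, hc.isGeodesic_cons h hac hp, fun i hi hin => ?_⟩
  have := hp.dist_left (i - 1) (by omega)
  simp only [show i ≠ 0 by omega, if_false]
  omega

theorem Connected.height_le_of_dist_add_dist_eq (hc : G.Connected) {h : V → ℕ}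
    (hlip : ∀ a b, G.Adj a b → h a ≤ h b + 1) {N : ℕ}
    (hA : ∀ j, 2 * j ≤ N → G.LowerNeighborsClique h j)
    (hT : ∀ j, 1 ≤ j → 2 * j < N → G.EdgesDescend h j) (m : ℕ) :
    ∀ (a b c : V) (r : ℕ), G.dist a b = m → G.dist a c + G.dist c b = m → h a ≤ r → h b ≤ r →
      m + h a + h b ≤ N → h c ≤ r := by
  induction m using Nat.strong_induction_on with
  | _ m ih =>
  intro a b c r hab hacb har hbr hN
  by_contra! hcr
  have hac0 : G.dist a c ≠ 0 := fun h0 => by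
    obtain rfl := hc.dist_eq_zero_iff.1 h0
    omega
  have hcb0 : G.dist b c ≠ 0 := fun h0 => by
    obtain rfl := hc.dist_eq_zero_iff.1 h0
    omega
  have hcomm : G.dist c b = G.dist b c := G.dist_comm
  obtain ⟨s, hs⟩ := Nat.exists_eq_succ_of_ne_zero hac0
  obtain ⟨t, ht⟩ := Nat.exists_eq_succ_of_ne_zero hcb0
  obtain ⟨a', haa', ha'c⟩ := hc.exists_adj_dist_eq hs
  obtain ⟨b', hbb', hb'c⟩ := hc.exists_adj_dist_eq ht
  have hla := hlip a' a haa'.symm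
  have hlb := hlip b' b hbb'.symm
  have hcb'comm : G.dist c b' = G.dist b' c := G.dist_comm
  have t1 := hc.dist_triangle (u := a') (v := c) (w := b)
  have t2 := hc.dist_triangle (u := a) (v := c) (w := b')
  have t3 := hc.dist_triangle (u := a') (v := c) (w := b')
  have t4 := hc.dist_le_dist_add_one' b haa'
  have t5 := hc.dist_le_dist_add_one a hbb'
  have t6 := hc.dist_le_dist_add_one a' hbb'
  have ha' : r < h a' := by
    by_contra! hle
    have := ih (m - 1) (by omega) a' b c r (by omega) (by omega) hle hbr (by omega)
    omega
  have hb' : r < h b' := by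
    by_contra! hle
    have := ih (m - 1) (by omega) a b' c r (by omega) (by omega) har hle (by omega)
    omega
  by_cases hm : m = 2
  · have h0 : G.dist a' b' = 0 := by omega
    obtain rfl := hc.dist_eq_zero_iff.1 h0
    rcases hA (r + 1) (by omega) a' a b (by omega) haa'.symm hbb'.symm (by omega) (by omega)
      with rfl | had
    · simp at hab; omega
    · have := SimpleGraph.dist_eq_one_iff_adj.2 had
      omega
  · obtain ⟨e, ha'e, heb'⟩ := hc.exists_adj_dist_eq (a := a') (b := b') (n := m - 3) (by omega)
    have hae' := SimpleGraph.dist_eq_one_iff_adj.2 ha'e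
    have s1 := hc.dist_le_dist_add_one e hbb'
    have s2 := hc.dist_le_dist_add_one' e haa'
    have s3 := hc.dist_triangle (u := a) (v := e) (w := b)
    have he : h e ≤ r + 1 :=
      ih (m - 2) (by omega) a' b' e (r + 1) (by omega) (by omega) (by omega) (by omega) (by omega)
    have he' : r < h e := by
      by_contra! hle
      have := ih 2 (by omega) a e a' r (by omega) (by
        rw [SimpleGraph.dist_eq_one_iff_adj.2 haa', hae']) har hle (by omega)
      omega
    obtain ⟨y, ha'y, hey, hy⟩ := hT (r + 1) (by omega) (by omega) a' e ha'e (by omega) (by omega)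
    have u1 := hc.dist_le_dist_add_one' b hey.symm
    have hyb : G.dist a b ≤ G.dist y b + 1 := by
      rcases hA (r + 1) (by omega) a' a y (by omega) haa'.symm ha'y (by omega) hy with rfl | had
      · omega
      · exact hc.dist_le_dist_add_one' b had
    have := ih (m - 1) (by omega) y b e r (by omega) (by
      rw [SimpleGraph.dist_eq_one_iff_adj.2 hey.symm]; omega) (by omega) hbr (by omega)
    omega

/-- A closed sequence of vertices without shortcuts in a bridged graph has length three. -/
theorem Connected.closed_length_eq_three (hc : G.Connected) (hb : Bridged G) {n : ℕ} (hn : 3 ≤ n)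
    (f : ℕ → V) (hadj : ∀ i, i + 1 < n → G.Adj (f i) (f (i + 1))) (hlast : G.Adj (f (n - 1)) (f 0))
    (hd : ∀ i j, i ≤ j → j < n → min (j - i) (n - (j - i)) ≤ G.dist (f i) (f j)) : n = 3 := by
  have : NeZero n := ⟨by omega⟩
  have hup : ∀ i t, i + t < n → G.dist (f i) (f (i + t)) ≤ t := by
    intro i t
    induction t with
    | zero => simp
    | succ t ih =>
      intro h
      have h1 := ih (by omega)
      have h2 := hc.dist_le_dist_add_one (f i) (hadj (i + t) (by omega)).symm
      rw [← add_assoc]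
      omega
  have hupn : ∀ i j, i ≤ j → j < n → G.dist (f i) (f j) ≤ min (j - i) (n - (j - i)) := by
    intro i j hij hj
    have h1 := hup i (j - i) (by omega)
    have h2 := hup j (n - 1 - j) (by omega)
    have h3 := hup 0 i (by omega)
    rw [show i + (j - i) = j by omega] at h1
    rw [show j + (n - 1 - j) = n - 1 by omega] at h2
    rw [show 0 + i = i by omega] at h3
    have h4 := hc.dist_triangle (u := f j) (v := f (n - 1)) (w := f i)
    have h5 := hc.dist_le_dist_add_one' (f i) hlast
    rw [G.dist_comm (u := f j)] at h4
    omega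
  have heq : ∀ i j, i ≤ j → j < n → G.dist (f i) (f j) = min (j - i) (n - (j - i)) :=
    fun i j hij hj => le_antisymm (hupn i j hij hj) (hd i j hij hj)
  have hcyc : ∀ i j : ZMod n, i.val ≤ j.val →
      G.dist (f i.val) (f j.val) = min (i - j).val (j - i).val := by
    intro i j hij
    have hj := j.val_lt
    rw [heq _ _ hij hj, ZMod.val_sub hij]
    rcases eq_or_ne i j with rfl | hne
    · simp
    · have : NeZero (j - i) := ⟨sub_ne_zero.2 hne.symm⟩
      rw [← neg_sub j i, ZMod.val_neg_of_ne_zero, ZMod.val_sub hij, min_comm]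
  have hdist : ∀ i j : ZMod n, G.dist (f i.val) (f j.val) = min (i - j).val (j - i).val := by
    intro i j
    rcases le_total i.val j.val with hij | hij
    · exact hcyc i j hij
    · rw [G.dist_comm, hcyc j i hij, min_comm]
  refine hb n (fun i => f i.val) ⟨hn, ?_, ?_, hdist⟩
  · intro i j hij
    have h0 := hdist i j
    simp only at hij
    rw [hij, SimpleGraph.dist_self] at h0
    rcases le_total (i - j).val (j - i).val with h | h
    · rw [min_eq_left h] at h0
      exact sub_eq_zero.1 ((ZMod.val_eq_zero _).1 h0.symm)
    · rw [min_eq_right h] at h0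
      exact (sub_eq_zero.1 ((ZMod.val_eq_zero _).1 h0.symm)).symm
  · intro i
    have hi := i.val_lt
    have : Fact (1 < n) := ⟨by omega⟩
    rcases Nat.lt_or_ge (i.val + 1) n with h | h
    · have hv : (i + 1).val = i.val + 1 := by
        rw [ZMod.val_add_of_lt, ZMod.val_one]
        rwa [ZMod.val_one]
      simp only [hv]
      exact hadj _ h
    · have hv : (i + 1).val = 0 := by
        have := ZMod.val_add_val_of_le (a := i) (b := 1) (by rwa [ZMod.val_one])
        rw [ZMod.val_one] at this
        omega
      simp only [hv]
      rwa [show i.val = n - 1 by omega]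

/-- Two geodesics from a common vertex whose far ends are equal (`e = 0`) or adjacent (`e = 1`)
admit a shortcut between them in a bridged graph. -/
theorem Connected.exists_shortcut (hc : G.Connected) (hb : Bridged G) {k e : ℕ} (hk : 2 ≤ k)
    {p q : ℕ → V} (h0 : p 0 = q 0)
    (hpadj : ∀ i < k, G.Adj (p i) (p (i + 1))) (hqadj : ∀ i < k, G.Adj (q i) (q (i + 1)))
    (hp : ∀ i ≤ k, G.dist (p 0) (p i) = i) (hq : ∀ i ≤ k, G.dist (q 0) (q i) = i)
    (he : e = 0 ∧ p k = q k ∨ e = 1 ∧ G.Adj (p k) (q k)) :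
    ∃ i j, 1 ≤ i ∧ i ≤ k ∧ 1 ≤ j ∧ j ≤ k ∧ G.dist (p i) (q j) < i + j ∧
      G.dist (p i) (q j) + i + j < 2 * k + e := by
  by_contra! hcon
  have he1 : e ≤ 1 := by omega
  have hpp : ∀ (p : ℕ → V), (∀ i ≤ k, G.dist (p 0) (p i) = i) →
      ∀ i j, i ≤ j → j ≤ k → j - i ≤ G.dist (p i) (p j) := by
    intro p hp i j hij hj
    have h1 := hp i (by omega)
    have h2 := hp j hj
    have h3 := hc.dist_triangle (u := p 0) (v := p i) (w := p j)
    omega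
  have := hc.closed_length_eq_three hb (n := 2 * k + e) (by omega)
    (fun t => if t ≤ k then p t else q (2 * k + e - t)) ?_ ?_ ?_
  · omega
  · intro i hi
    rcases Nat.lt_trichotomy i k with h | rfl | h
    · rw [if_pos (by omega), if_pos (by omega)]
      exact hpadj i h
    · rw [if_pos le_rfl, if_neg (by omega)]
      rcases he with ⟨rfl, he⟩ | ⟨rfl, he⟩
      · rw [he]
        have := hqadj (i - 1) (by omega)
        rw [show i - 1 + 1 = i by omega] at this
        rw [show 2 * i + 0 - (i + 1) = i - 1 by omega]
        exact this.symm
      · rwa [show 2 * i + 1 - (i + 1) = i by omega]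
    · rw [if_neg (by omega), if_neg (by omega)]
      have := hqadj (2 * k + e - (i + 1)) (by omega)
      rw [show 2 * k + e - (i + 1) + 1 = 2 * k + e - i by omega] at this
      exact this.symm
  · rw [if_neg (by omega), if_pos (by omega), h0,
      show 2 * k + e - (2 * k + e - 1) = 0 + 1 by omega]
    exact (hqadj 0 (by omega)).symm
  · intro i j hij hj
    by_cases hjk : j ≤ k
    · rw [if_pos (by omega), if_pos hjk]
      have := hpp p hp i j hij hjk
      omega
    · rw [if_neg hjk]
      by_cases hik : i ≤ k
      · rw [if_pos hik]
        rcases Nat.eq_zero_or_pos i with rfl | hi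
        · rw [h0, hq _ (by omega)]
          omega
        · have := hcon i (2 * k + e - j) hi hik (by omega) (by omega)
          omega
      · rw [if_neg hik]
        have := hpp q hq (2 * k + e - j) (2 * k + e - i) (by omega) (by omega)
        rw [G.dist_comm]
        omega

theorem Connected.eq_or_adj_of_dist_lt_two (hc : G.Connected) {a b : V} (h : G.dist a b < 2) :
    a = b ∨ G.Adj a b := by
  rcases Nat.eq_zero_or_pos (G.dist a b) with h0 | h0
  · exact Or.inl (hc.dist_eq_zero_iff.1 h0)
  · exact Or.inr (SimpleGraph.dist_eq_one_iff_adj.1 (by omega))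

theorem Connected.four_cycle_chord (hc : G.Connected) (hb : Bridged G) {x a b c : V}
    (hxa : G.Adj x a) (hxb : G.Adj x b) (hac : G.Adj a c) (hbc : G.Adj b c)
    (hxc : G.dist x c = 2) : a = b ∨ G.Adj a b := by
  obtain ⟨i, j, hi, hik, hj, hjk, h1, h2⟩ := hc.exists_shortcut hb (k := 2) (e := 0) le_rfl
    (p := fun i => if i = 0 then x else if i = 1 then a else c)
    (q := fun i => if i = 0 then x else if i = 1 then b else c) rfl
    (by intro i hi; interval_cases i <;> simpa) (by intro i hi; interval_cases i <;> simpa)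
    (by intro i hi; interval_cases i <;> simp [SimpleGraph.dist_eq_one_iff_adj, hxa, hxc])
    (by intro i hi; interval_cases i <;> simp [SimpleGraph.dist_eq_one_iff_adj, hxb, hxc])
    (Or.inl ⟨rfl, rfl⟩)
  have hac' := SimpleGraph.dist_eq_one_iff_adj.2 hac
  have hcb' := SimpleGraph.dist_eq_one_iff_adj.2 hbc.symm
  apply hc.eq_or_adj_of_dist_lt_two
  interval_cases i <;> interval_cases j <;> simp at h1 h2 <;> omega

theorem Connected.five_cycle_chord (hc : G.Connected) (hb : Bridged G) {x a b c d : V}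
    (hxa : G.Adj x a) (hxb : G.Adj x b) (hac : G.Adj a c) (hbd : G.Adj b d) (hcd : G.Adj c d)
    (hxc : G.dist x c = 2) (hxd : G.dist x d = 2) : a = b ∨ G.Adj a b := by
  obtain ⟨i, j, hi, hik, hj, hjk, h1, h2⟩ := hc.exists_shortcut hb (k := 2) (e := 1) le_rfl
    (p := fun i => if i = 0 then x else if i = 1 then a else c)
    (q := fun i => if i = 0 then x else if i = 1 then b else d) rfl
    (by intro i hi; interval_cases i <;> simpa) (by intro i hi; interval_cases i <;> simpa)
    (by intro i hi; interval_cases i <;> simp [SimpleGraph.dist_eq_one_iff_adj, hxa, hxc])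
    (by intro i hi; interval_cases i <;> simp [SimpleGraph.dist_eq_one_iff_adj, hxb, hxd])
    (Or.inr ⟨rfl, hcd⟩)
  have hxa' := SimpleGraph.dist_eq_one_iff_adj.2 hxa
  have hxb' := SimpleGraph.dist_eq_one_iff_adj.2 hxb
  have hcd' := SimpleGraph.dist_eq_one_iff_adj.2 hcd
  interval_cases i <;> interval_cases j <;> simp at h1 h2
  · exact hc.eq_or_adj_of_dist_lt_two (by omega)
  · rcases hc.eq_or_adj_of_dist_lt_two (show G.dist a d < 2 by omega) with rfl | had
    · omega
    · exact hc.four_cycle_chord hb hxa hxb had hbd hxd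
  · rcases hc.eq_or_adj_of_dist_lt_two (show G.dist c b < 2 by omega) with rfl | hcb
    · omega
    · exact hc.four_cycle_chord hb hxa hxb hac hcb.symm hxc
  · omega

/-- A height function `g` with value `k` at `x`, for which the clique and descent conditions hold
below `k`, together with the corresponding conditions for distances up to about `k`. -/
structure Cone (G : SimpleGraph V) (x : V) (g : V → ℕ) (k N : ℕ) : Prop where
  conn : G.Connected
  bridged : Bridged G
  two_le : 2 ≤ k
  le_bound : 2 * k ≤ N + 1
  bound_le : N ≤ 2 * k
  apex : g x = k
  lip : ∀ a b, G.Adj a b → g a ≤ g b + 1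
  clique : ∀ u j, 2 * j ≤ N → G.LowerNeighborsClique (G.dist u) j
  descend : ∀ u j, 1 ≤ j → j < k → G.EdgesDescend (G.dist u) j
  height_clique : ∀ j, j < k → G.LowerNeighborsClique g j
  height_descend : ∀ j, 1 ≤ j → j < k → G.EdgesDescend g j

/-- All first steps from `x` towards `y` and towards `y'` are pairwise equal or adjacent. -/
def Linked (G : SimpleGraph V) (x y y' : V) : Prop :=
  ∀ r r', G.Adj x r → G.Adj x r' → G.dist r y + 1 = G.dist x y → G.dist r' y' + 1 = G.dist x y' →
    r = r' ∨ G.Adj r r'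

theorem Linked.symm {x y y' : V} (h : G.Linked x y y') : G.Linked x y' y := by
  intro r r' hr hr' h1 h2
  rcases h r' r hr' hr h2 h1 with h | h
  · exact Or.inl h.symm
  · exact Or.inr h.symm

namespace Cone

variable {x : V} {g : V → ℕ} {k N : ℕ}

theorem le_height_add_dist (h : G.Cone x g k N) (y z : V) : g y ≤ g z + G.dist y z := by
  obtain ⟨p, hp⟩ := h.conn.exists_walk_length_eq_dist y z
  rw [← hp]
  clear hp
  induction p with
  | nil => simp
  | cons hadj p ih =>
    have := h.lip _ _ hadj
    simp only [SimpleGraph.Walk.length_cons]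
    omega

theorem le_dist_add_height (h : G.Cone x g k N) (y : V) : k ≤ G.dist x y + g y := by
  have := h.le_height_add_dist x y
  rw [h.apex] at this
  omega

theorem eq_or_adj_trans (h : G.Cone x g k N) {a r b : V} (hxa : G.Adj x a) (hxr : G.Adj x r)
    (hxb : G.Adj x b) (ha : g a + 1 = k) (hr : g r + 1 = k) (hb : g b + 1 = k)
    (har : a = r ∨ G.Adj a r) (hrb : r = b ∨ G.Adj r b) : a = b ∨ G.Adj a b := by
  have hk := h.two_le
  rcases har with rfl | har
  · exact hrb
  rcases hrb with rfl | hrb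
  · exact Or.inr har
  obtain ⟨c, hac, hrc, hgc⟩ := h.height_descend (k - 1) (by omega) (by omega) a r har
    (by omega) (by omega)
  obtain ⟨d, hrd, hbd, hgd⟩ := h.height_descend (k - 1) (by omega) (by omega) r b hrb
    (by omega) (by omega)
  have hxr' := SimpleGraph.dist_eq_one_iff_adj.2 hxr
  have hxc : G.dist x c = 2 := by
    have := h.le_dist_add_height c
    have := h.conn.dist_le_dist_add_one x hrc.symm
    omega
  have hxd : G.dist x d = 2 := by
    have := h.le_dist_add_height d
    have := h.conn.dist_le_dist_add_one x hrd.symm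
    omega
  rcases h.height_clique (k - 1) (by omega) r c d (by omega) hrc hrd hgc hgd with rfl | hcd
  · exact h.conn.four_cycle_chord h.bridged hxa hxb hac hbd hxc
  · exact h.conn.five_cycle_chord h.bridged hxa hxb hac hbd hcd hxc hxd

theorem linked_self (h : G.Cone x g k N) {y : V} (hy : G.dist x y < k) : G.Linked x y y := by
  intro r r' hr hr' h1 h2
  have := h.le_bound
  rw [G.dist_comm, G.dist_comm (u := x)] at h1 h2
  exact h.clique y _ (by rw [G.dist_comm (u := y)]; omega) x r r' rfl hr hr' h1 h2

theorem height_first_step (h : G.Cone x g k N) {r y : V} (hr : G.Adj x r)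
    (hy : G.dist x y + g y = k) (hd : G.dist r y + 1 = G.dist x y) : g r + 1 = k := by
  have h1 := h.le_height_add_dist r y
  have h2 := h.lip _ _ hr
  rw [h.apex] at h2
  omega

theorem exists_first_step (hc : G.Connected) {y : V} (hy : 1 ≤ G.dist x y) :
    ∃ r, G.Adj x r ∧ G.dist r y + 1 = G.dist x y := by
  obtain ⟨r, hr, hd⟩ := hc.exists_adj_dist_eq (a := x) (b := y) (n := G.dist x y - 1) (by omega)
  exact ⟨r, hr, by omega⟩

theorem linked_trans (h : G.Cone x g k N) {a b c : V} (ha : G.dist x a + g a = k)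
    (hb : G.dist x b + g b = k) (hc : G.dist x c + g c = k) (hb1 : 1 ≤ G.dist x b)
    (hab : G.Linked x a b) (hbc : G.Linked x b c) : G.Linked x a c := by
  intro r r' hr hr' h1 h2
  obtain ⟨s, hs, hsd⟩ := exists_first_step h.conn hb1
  exact h.eq_or_adj_trans hr hs hr' (h.height_first_step hr ha h1) (h.height_first_step hs hb hsd)
    (h.height_first_step hr' hc h2) (hab r s hr hs h1 hsd) (hbc s r' hs hr' hsd h2)

theorem linked_of_adj_of_lt (h : G.Cone x g k N) {y y' : V} (hadj : G.Adj y y')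
    (hy' : G.dist x y' < k) (hlt : G.dist x y < G.dist x y') : G.Linked x y y' := by
  intro r r' hr hr' h1 h2
  have e1 := h.conn.dist_le_dist_add_one x hadj.symm
  have e2 := h.conn.dist_le_dist_add_one r hadj.symm
  have e3 := h.conn.dist_le_dist_add_one' y' hr
  exact h.linked_self hy' r r' hr hr' (by omega) h2

theorem linked_of_adj (h : G.Cone x g k N) {y y' : V} (hadj : G.Adj y y')
    (hy : G.dist x y + g y = k) (hy' : G.dist x y' + g y' = k) (hy1 : 1 ≤ G.dist x y)
    (hyk : G.dist x y < k) (hyk' : G.dist x y' < k) : G.Linked x y y' := by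
  rcases Nat.lt_trichotomy (G.dist x y) (G.dist x y') with hlt | heq | hlt
  · exact h.linked_of_adj_of_lt hadj hyk' hlt
  · obtain ⟨t, hyt, hyt', ht⟩ := h.descend x _ hy1 hyk y y' hadj rfl heq.symm
    rcases Nat.eq_zero_or_pos (G.dist x t) with h0 | h0
    · intro r r' hr hr' h1 h2
      obtain rfl := h.conn.dist_eq_zero_iff.1 (show G.dist r y = 0 by omega)
      obtain rfl := h.conn.dist_eq_zero_iff.1 (show G.dist r' y' = 0 by omega)
      exact Or.inr hadj
    · have hgt := h.le_dist_add_height t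
      have hgt' := h.lip _ _ hyt.symm
      exact h.linked_trans hy (by omega) hy' h0
        (h.linked_of_adj_of_lt hyt.symm hyk (by omega)).symm
        (h.linked_of_adj_of_lt hyt'.symm hyk' (by omega))
  · exact (h.linked_of_adj_of_lt hadj.symm hyk hlt).symm

theorem dist_le_of_between (h : G.Cone x g k N) {a b c : V} {r : ℕ}
    (hc : G.dist a c + G.dist c b = G.dist a b) (ha : G.dist x a ≤ r) (hb : G.dist x b ≤ r)
    (hN : G.dist a b + G.dist x a + G.dist x b ≤ N) : G.dist x c ≤ r := by
  have := h.bound_le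
  exact h.conn.height_le_of_dist_add_dist_eq
    (fun _ _ hadj => h.conn.dist_le_dist_add_one x hadj) (fun j hj => h.clique x j hj)
    (fun j hj1 hj => h.descend x j hj1 (by omega)) _ a b c r rfl hc ha hb hN

theorem height_le_of_between (h : G.Cone x g k N) {a b c : V} {r : ℕ}
    (hc : G.dist a c + G.dist c b = G.dist a b) (ha : g a ≤ r) (hb : g b ≤ r)
    (hN : G.dist a b + g a + g b < 2 * k) : g c ≤ r := by
  have := h.two_le
  exact h.conn.height_le_of_dist_add_dist_eq h.lip (N := 2 * k - 1)
    (fun j hj => h.height_clique j (by omega))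
    (fun j hj1 hj => h.height_descend j hj1 (by omega)) _ a b c r rfl hc ha hb (by omega)

/-- `y` lies strictly inside the interval between `x` and the vertices of height zero. -/
def Inside (G : SimpleGraph V) (x : V) (g : V → ℕ) (k : ℕ) (y : V) : Prop :=
  G.dist x y + g y = k ∧ 1 ≤ G.dist x y ∧ G.dist x y < k

theorem linked_of_dist_lt_of_le (h : G.Cone x g k N) {y y' : V}
    (hy : Inside G x g k y) (hy' : Inside G x g k y') (hle : G.dist x y ≤ G.dist x y')
    (hlt : G.dist y y' < G.dist x y + G.dist x y')
    (hN : G.dist y y' + G.dist x y + G.dist x y' ≤ N)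
    (ih : ∀ z z', Inside G x g k z → Inside G x g k z' →
      G.dist z z' < G.dist x z + G.dist x z' → G.dist z z' + G.dist x z + G.dist x z' ≤ N →
      (G.dist z z' < G.dist y y' ∨ G.dist z z' = G.dist y y' ∧ G.dist x y < G.dist x z ∧
        G.dist x z ≤ G.dist x z' ∧ G.dist x z' < G.dist x y') → G.Linked x z z') :
    G.Linked x y y' := by
  obtain ⟨hy0, hy1, hyk⟩ := hy
  obtain ⟨hy0', hy1', hyk'⟩ := hy'
  rcases Nat.eq_zero_or_pos (G.dist y y') with hd | hd
  · obtain rfl := h.conn.dist_eq_zero_iff.1 hd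
    exact h.linked_self hyk
  by_cases hd1 : G.dist y y' = 1
  · exact h.linked_of_adj (SimpleGraph.dist_eq_one_iff_adj.1 hd1) hy0 hy0' hy1 hyk hyk'
  obtain ⟨a, hya, hay'⟩ := h.conn.exists_adj_dist_eq (a := y) (b := y')
    (n := G.dist y y' - 1) (by omega)
  obtain ⟨b, hby', hab⟩ := h.conn.exists_adj_dist_eq (a := y') (b := a)
    (n := G.dist y y' - 2) (by rw [G.dist_comm]; omega)
  rw [G.dist_comm] at hab
  have hya1 := SimpleGraph.dist_eq_one_iff_adj.2 hya
  have hby1 := SimpleGraph.dist_eq_one_iff_adj.2 hby'.symm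
  have hyb : G.dist y b + 1 = G.dist y y' := by
    have := h.conn.dist_le_dist_add_one' b hya
    have := h.conn.dist_le_dist_add_one y hby'
    omega
  have fa : G.dist x a ≤ G.dist x y' := h.dist_le_of_between (a := y) (b := y') (by omega)
    hle le_rfl hN
  have fb : G.dist x b ≤ G.dist x y' := h.dist_le_of_between (a := y) (b := y') (by omega)
    hle le_rfl hN
  have ga : g a ≤ g y := h.height_le_of_between (a := y) (b := y') (by omega)
    le_rfl (by omega) (by omega)
  have gb : g b ≤ g y := h.height_le_of_between (a := y) (b := y') (by omega)
    le_rfl (by omega) (by omega)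
  have fa1 := h.conn.dist_le_dist_add_one x hya
  have fa2 := h.conn.dist_le_dist_add_one x hya.symm
  have fb2 := h.conn.dist_le_dist_add_one x hby'
  have ga2 := h.lip _ _ hya
  have gb1 := h.lip _ _ hby'.symm
  have ka := h.le_dist_add_height a
  have kb := h.le_dist_add_height b
  have viaA : G.dist x a + g a = k → G.Linked x y y' := by
    intro ha
    have ha' : Inside G x g k a := ⟨ha, by omega, by omega⟩
    exact h.linked_trans hy0 ha hy0' ha'.2.1 (h.linked_of_adj hya hy0 ha hy1 hyk ha'.2.2)
      (ih a y' ha' ⟨hy0', hy1', hyk'⟩ (by omega) (by omega) (by omega))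
  have viaB : G.dist x b + g b = k → G.Linked x y y' := by
    intro hb
    have hb' : Inside G x g k b := ⟨hb, by omega, by omega⟩
    exact h.linked_trans hy0 hb hy0' hb'.2.1
      (ih y b ⟨hy0, hy1, hyk⟩ hb' (by omega) (by omega) (by omega))
      (h.linked_of_adj hby'.symm hb hy0' hb'.2.1 hb'.2.2 hyk')
  by_cases ha : G.dist x a + g a = k
  · exact viaA ha
  by_cases hb : G.dist x b + g b = k
  · exact viaB hb
  obtain ⟨c, hyc, hac, hgc⟩ := h.height_descend (g y) (by omega) (by omega) y a hya rfl (by omega)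
  obtain ⟨d, hyd, hbd, hfd⟩ := h.descend x (G.dist x y') hy1' hyk' y' b hby' rfl (by omega)
  have kc := h.le_dist_add_height c
  have kd := h.le_dist_add_height d
  have fc := h.conn.dist_le_dist_add_one x hyc.symm
  have gd := h.lip _ _ hyd.symm
  have hyd_le := h.conn.dist_le_dist_add_one y hbd.symm
  have had_le := h.conn.dist_le_dist_add_one a hbd.symm
  have hcd_le := h.conn.dist_le_dist_add_one' d hac.symm
  have hyd_le' := h.conn.dist_le_dist_add_one' d hya
  have hd' : Inside G x g k d := ⟨by omega, by omega, by omega⟩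
  have hdy' := h.linked_of_adj hyd.symm hd'.1 hy0' hd'.2.1 hd'.2.2 hyk'
  by_cases hj : G.dist x y' = G.dist x y + 1
  · by_cases hyd' : G.dist y d < G.dist y y'
    · exact h.linked_trans hy0 hd'.1 hy0' hd'.2.1
        (ih y d ⟨hy0, hy1, hyk⟩ hd' (by omega) (by omega) (Or.inl hyd')) hdy'
    · have := h.dist_le_of_between (a := y) (b := d) (c := a) (r := G.dist x y)
        (by omega) le_rfl (by omega) (by omega)
      omega
  · have hc' : Inside G x g k c := ⟨by omega, by omega, by omega⟩
    exact h.linked_trans hy0 hc'.1 hy0' hc'.2.1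
      (h.linked_of_adj hyc hy0 hc'.1 hy1 hyk hc'.2.2)
      (h.linked_trans hc'.1 hd'.1 hy0' hd'.2.1
        (ih c d hc' hd' (by omega) (by omega) (by omega)) hdy')

theorem linked_of_dist_lt (h : G.Cone x g k N) (m : ℕ) : ∀ (D : ℕ) (y y' : V),
    Inside G x g k y → Inside G x g k y' → G.dist y y' = m →
    (G.dist x y - G.dist x y') + (G.dist x y' - G.dist x y) = D →
    m < G.dist x y + G.dist x y' → m + G.dist x y + G.dist x y' ≤ N → G.Linked x y y' := by
  induction m using Nat.strong_induction_on with
  | _ m ihm =>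
  intro D
  induction D using Nat.strong_induction_on with
  | _ D ihD =>
  have key : ∀ y y' : V, Inside G x g k y → Inside G x g k y' → G.dist y y' = m →
      (G.dist x y - G.dist x y') + (G.dist x y' - G.dist x y) = D →
      m < G.dist x y + G.dist x y' → m + G.dist x y + G.dist x y' ≤ N →
      G.dist x y ≤ G.dist x y' → G.Linked x y y' := by
    intro y y' hy hy' hm hD hlt hN hle
    refine h.linked_of_dist_lt_of_le hy hy' hle (by omega) (by omega) ?_
    rintro z z' hz hz' h1 h2 (h3 | ⟨h3, h4, h5, h6⟩)
    · exact ihm _ (by omega) _ z z' hz hz' rfl rfl h1 h2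
    · exact ihD _ (by omega) z z' hz hz' (by omega) rfl (by omega) (by omega)
  intro y y' hy hy' hm hD hlt hN
  rcases le_total (G.dist x y) (G.dist x y') with hle | hle
  · exact key y y' hy hy' hm hD hlt hN hle
  · exact (key y' y hy' hy (by rwa [G.dist_comm]) (by omega) (by omega) (by omega) hle).symm

end Cone
theorem Cone.eq_or_adj_of_fan {x : V} {g : V → ℕ} {k N e : ℕ} (h : G.Cone x g k N)
    (hN : N + 1 = 2 * k + e) {v w a b : V} (hv : g v = 0) (hw : g w = 0)
    (he : e = 0 ∧ v = w ∨ e = 1 ∧ G.Adj v w) (hxv : G.dist x v = k) (hxw : G.dist x w = k)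
    (hxa : G.Adj x a) (hxb : G.Adj x b) (hav : G.dist a v + 1 = k) (hbw : G.dist b w + 1 = k) :
    a = b ∨ G.Adj a b := by
  have hk := h.two_le
  have hc := h.conn
  have near : ∀ t, e = 1 → G.dist x t = k → G.dist a t + 1 = k → G.dist b t + 1 = k →
      a = b ∨ G.Adj a b := by
    intro t h1 h2 h3 h4
    rw [G.dist_comm] at h2 h3 h4
    exact h.clique t k (by omega) x a b h2 hxa hxb h3 h4
  obtain ⟨p, hp, hpa⟩ := hc.exists_isGeodesic_through hxv hxa hav
  obtain ⟨q, hq, hqb⟩ := hc.exists_isGeodesic_through hxw hxb hbw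
  obtain ⟨i, j, hi, hik, hj, hjk, h1, h2⟩ := hc.exists_shortcut h.bridged (e := e) hk
    (hp.start.trans hq.start.symm) hp.adj hq.adj (by rw [hp.start]; exact hp.dist_left)
    (by rw [hq.start]; exact hq.dist_left) (by rwa [hp.finish, hq.finish])
  have bp := hpa i hi hik
  have bq := hqb j hj hjk
  have lp := hp.dist_left i hik
  have lq := hq.dist_left j hjk
  have rp := hp.dist_right i hik
  have rq := hq.dist_right j hjk
  by_cases hi' : i = k
  · subst hi'
    rw [hp.finish] at h1 h2
    rcases he with ⟨rfl, rfl⟩ | ⟨rfl, -⟩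
    · rw [G.dist_comm] at h2
      omega
    · have t1 := hc.dist_triangle (u := b) (v := q j) (w := v)
      have t2 := hc.dist_le_dist_add_one' v hxb
      rw [G.dist_comm (u := q j)] at t1
      exact near v rfl hxv hav (by omega)
  by_cases hj' : j = k
  · subst hj'
    rw [hq.finish] at h1 h2
    rcases he with ⟨rfl, rfl⟩ | ⟨rfl, -⟩
    · omega
    · have t1 := hc.dist_triangle (u := a) (v := p i) (w := w)
      have t2 := hc.dist_le_dist_add_one' w hxa
      exact near w rfl hxw (by omega) hbw
  have gp := h.le_height_add_dist (p i) v
  have gq := h.le_height_add_dist (q j) w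
  have kp := h.le_dist_add_height (p i)
  have kq := h.le_dist_add_height (q j)
  exact h.linked_of_dist_lt _ _ (p i) (q j) ⟨by omega, by omega, by omega⟩
    ⟨by omega, by omega, by omega⟩ rfl rfl (by omega) (by omega) a b hxa hxb (by omega) (by omega)

/-- For an edge at distance `j` from `x`, a first step from `x` towards one end and a first step
towards the other end are equal or adjacent. -/
def FirstStepsClose (G : SimpleGraph V) (j : ℕ) : Prop :=
  ∀ x v w a b : V, G.Adj v w → G.dist x v = j → G.dist x w = j → G.Adj x a → G.Adj x b →
    G.dist a v + 1 = j → G.dist b w + 1 = j → a = b ∨ G.Adj a b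

theorem Connected.lowerNeighborsClique_of_lt (hc : G.Connected) (hb : Bridged G) {k : ℕ}
    (hA : ∀ u j, j < k → G.LowerNeighborsClique (G.dist u) j)
    (hT : ∀ u j, 1 ≤ j → j < k → G.EdgesDescend (G.dist u) j) (u : V) :
    G.LowerNeighborsClique (G.dist u) k := by
  intro p a b hp hpa hpb ha hb'
  by_cases hk : 2 ≤ k
  · have h : G.Cone p (G.dist u) k (2 * k - 1) :=
      ⟨hc, hb, hk, by omega, by omega, hp, fun _ _ hadj => hc.dist_le_dist_add_one u hadj,
        fun u j hj => hA u j (by omega), hT, hA u, hT u⟩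
    rw [G.dist_comm] at hp ha hb'
    exact h.eq_or_adj_of_fan (e := 0) (by omega) G.dist_self G.dist_self (Or.inl ⟨rfl, rfl⟩) hp hp
      hpa hpb ha hb'
  · obtain rfl := hc.dist_eq_zero_iff.1 (show G.dist u a = 0 by omega)
    exact Or.inl (hc.dist_eq_zero_iff.1 (by omega))

theorem Connected.lowerNeighborsClique_min (hc : G.Connected) {k : ℕ}
    (hA : ∀ u j, j ≤ k → G.LowerNeighborsClique (G.dist u) j)
    (hF : ∀ j, j < k → G.FirstStepsClose j) {v w : V} (hvw : G.Adj v w) {j : ℕ} (hj : j < k) :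
    G.LowerNeighborsClique (fun y => min (G.dist v y) (G.dist w y)) j := by
  intro p a b hp hpa hpb ha hb
  simp only at hp ha hb
  have v1 := hc.dist_le_dist_add_one v hpa
  have v2 := hc.dist_le_dist_add_one v hpb
  have w1 := hc.dist_le_dist_add_one w hpa
  have w2 := hc.dist_le_dist_add_one w hpb
  have cv : ∀ y, G.dist y v = G.dist v y := fun y => G.dist_comm
  have cw : ∀ y, G.dist y w = G.dist w y := fun y => G.dist_comm
  rcases le_total (G.dist v a) (G.dist w a) with h1 | h1 <;>
    rcases le_total (G.dist v b) (G.dist w b) with h2 | h2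
  · exact hA v j hj.le p a b (by omega) hpa hpb (by omega) (by omega)
  · refine hF j hj p v w a b hvw ?_ ?_ hpa hpb ?_ ?_ <;> simp only [cv, cw] <;> omega
  · refine hF j hj p w v a b hvw.symm ?_ ?_ hpa hpb ?_ ?_ <;> simp only [cv, cw] <;> omega
  · exact hA w j hj.le p a b (by omega) hpa hpb (by omega) (by omega)

theorem Connected.dist_le_of_crossed_edges (hc : G.Connected) {j : ℕ}
    (hA : ∀ u, G.LowerNeighborsClique (G.dist u) (j + 1)) {v w y y' : V} (hvw : G.Adj v w)
    (hyy' : G.Adj y y') (hj : 1 ≤ j) (hv : G.dist v y = j) (hw : G.dist w y' = j) :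
    G.dist v y' ≤ j ∨ G.dist w y ≤ j := by
  by_contra! hcon
  obtain ⟨s, hys, hs⟩ := hc.exists_adj_dist_eq (a := y) (b := v) (n := j - 1)
    (by rw [G.dist_comm]; omega)
  rw [G.dist_comm] at hs
  have h1 := hc.dist_le_dist_add_one' s hvw.symm
  have h2 := hc.dist_le_dist_add_one w hys
  have h3 := hc.dist_le_dist_add_one w hyy'
  rcases hA w y s y' (by omega) hys hyy' (by omega) (by omega) with rfl | hadj
  · omega
  · have := hc.dist_le_dist_add_one v hadj.symm
    omega

theorem Connected.edgesDescend_min (hc : G.Connected) {k : ℕ}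
    (hA : ∀ u j, j ≤ k → G.LowerNeighborsClique (G.dist u) j)
    (hT : ∀ u j, 1 ≤ j → j < k → G.EdgesDescend (G.dist u) j) {v w : V} (hvw : G.Adj v w) {j : ℕ}
    (hj1 : 1 ≤ j) (hj : j < k) :
    G.EdgesDescend (fun y => min (G.dist v y) (G.dist w y)) j := by
  intro y y' hyy' hy hy'
  simp only at hy hy' ⊢
  have key : G.dist v y = j ∧ G.dist v y' = j ∨ G.dist w y = j ∧ G.dist w y' = j := by
    by_contra hne
    rcases le_total (G.dist v y) (G.dist w y) with h1 | h1 <;>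
      rcases le_total (G.dist v y') (G.dist w y') with h2 | h2
    · omega
    · have := hc.dist_le_of_crossed_edges (fun u => hA u (j + 1) hj) hvw hyy' hj1 (by omega)
        (by omega)
      omega
    · have := hc.dist_le_of_crossed_edges (fun u => hA u (j + 1) hj) hvw hyy'.symm hj1 (by omega)
        (by omega)
      omega
    · omega
  rcases key with ⟨h1, h2⟩ | ⟨h1, h2⟩
  · obtain ⟨c, h3, h4, h5⟩ := hT v j hj1 hj y y' hyy' h1 h2
    have := hc.dist_le_dist_add_one w h3
    exact ⟨c, h3, h4, by omega⟩
  · obtain ⟨c, h3, h4, h5⟩ := hT w j hj1 hj y y' hyy' h1 h2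
    have := hc.dist_le_dist_add_one v h3
    exact ⟨c, h3, h4, by omega⟩

theorem Connected.firstStepsClose_of_lt (hc : G.Connected) (hb : Bridged G) {k : ℕ}
    (hA : ∀ u j, j ≤ k → G.LowerNeighborsClique (G.dist u) j)
    (hT : ∀ u j, 1 ≤ j → j < k → G.EdgesDescend (G.dist u) j)
    (hF : ∀ j, j < k → G.FirstStepsClose j) : G.FirstStepsClose k := by
  intro x v w a b hvw hv hw hxa hxb ha hb'
  by_cases hk : 2 ≤ k
  · have h : G.Cone x (fun y => min (G.dist v y) (G.dist w y)) k (2 * k) := by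
      refine ⟨hc, hb, hk, by omega, by omega, ?_, ?_, fun u j hj => hA u j (by omega), hT,
        fun j hj => hc.lowerNeighborsClique_min hA hF hvw hj,
        fun j hj1 hj => hc.edgesDescend_min hA hT hvw hj1 hj⟩
      · rw [G.dist_comm, hv, G.dist_comm, hw, min_self]
      · intro y z hyz
        have := hc.dist_le_dist_add_one v hyz
        have := hc.dist_le_dist_add_one w hyz
        omega
    exact h.eq_or_adj_of_fan (e := 1) (by omega) (by simp) (by simp) (Or.inr ⟨rfl, hvw⟩) hv hw
      hxa hxb ha hb'
  · obtain rfl := hc.dist_eq_zero_iff.1 (show G.dist a v = 0 by omega)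
    obtain rfl := hc.dist_eq_zero_iff.1 (show G.dist b w = 0 by omega)
    exact Or.inr hvw

theorem Connected.edgesDescend_of_firstStepsClose (hc : G.Connected) {k : ℕ} (hk : 1 ≤ k)
    (hA : ∀ u, G.LowerNeighborsClique (G.dist u) k)
    (hT : ∀ u j, 1 ≤ j → j < k → G.EdgesDescend (G.dist u) j) (hF : G.FirstStepsClose k) (u : V) :
    G.EdgesDescend (G.dist u) k := by
  intro v w hvw hv hw
  by_cases hk1 : k = 1
  · exact ⟨u, (SimpleGraph.dist_eq_one_iff_adj.1 (hv.trans hk1)).symm,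
      (SimpleGraph.dist_eq_one_iff_adj.1 (hw.trans hk1)).symm, by simp [hk1]⟩
  obtain ⟨a, hua, hav⟩ := hc.exists_adj_dist_eq (a := u) (b := v) (n := k - 1) (by omega)
  obtain ⟨b, hub, hbw⟩ := hc.exists_adj_dist_eq (a := u) (b := w) (n := k - 1) (by omega)
  by_cases haw : G.dist a w = k - 1
  · obtain ⟨c, hvc, hwc, hc'⟩ := hT a (k - 1) (by omega) (by omega) v w hvw hav haw
    have h1 := hc.dist_le_dist_add_one' c hua
    have h2 := hc.dist_le_dist_add_one u hvc
    exact ⟨c, hvc, hwc, by omega⟩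
  rcases hF u v w a b hvw hv hw hua hub (by omega) (by omega) with rfl | hab
  · exact absurd hbw haw
  obtain ⟨q, hwq, hq⟩ := hc.exists_adj_dist_eq (a := w) (b := b) (n := k - 2)
    (by rw [G.dist_comm]; omega)
  rw [G.dist_comm] at hq
  have h1 := hc.dist_le_dist_add_one' w hab
  have h2 := hc.dist_le_dist_add_one' w hua
  have h3 := hc.dist_le_dist_add_one' q hab
  have h4 := hc.dist_le_dist_add_one a hwq
  have h5 := hc.dist_le_dist_add_one' q hub
  have h6 := hc.dist_le_dist_add_one u hwq
  rcases hA a w v q (by omega) hvw.symm hwq (by omega) (by omega) with rfl | hvq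
  · omega
  · exact ⟨q, hvq, hwq, by omega⟩

theorem Connected.edgesDescend_of_bridged (hc : G.Connected) (hb : Bridged G) (k : ℕ) :
    (∀ u, G.LowerNeighborsClique (G.dist u) k) ∧ G.FirstStepsClose k ∧
      (1 ≤ k → ∀ u, G.EdgesDescend (G.dist u) k) := by
  induction k using Nat.strong_induction_on with
  | _ k ih =>
  have hT : ∀ u j, 1 ≤ j → j < k → G.EdgesDescend (G.dist u) j :=
    fun u j hj1 hj => (ih j hj).2.2 hj1 u
  have hA := hc.lowerNeighborsClique_of_lt hb (fun u j hj => (ih j hj).1 u) hT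
  have hF := hc.firstStepsClose_of_lt hb (fun u j hj => by
    rcases hj.lt_or_eq with hj | rfl
    · exact (ih j hj).1 u
    · exact hA u) hT (fun j hj => (ih j hj).2.1)
  exact ⟨hA, hF, fun hk => hc.edgesDescend_of_firstStepsClose hk hA hT hF⟩

end SimpleGraph

/-- The triangle condition for connected `K₄`-free bridged graphs. -/
theorem triangle_condition {V : Type*} (G : SimpleGraph V)
    (hconn : G.Connected) (hK4 : K4Free G) (hbr : Bridged G) (u v w : V)
    (hvw : G.Adj v w) (heq : G.dist u v = G.dist u w) (hpos : 1 ≤ G.dist u v) :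
    ∃ x : V, G.Adj v x ∧ G.Adj w x ∧ G.dist u x + 1 = G.dist u v := by
  obtain ⟨x, hvx, hwx, hx⟩ :=
    (hconn.edgesDescend_of_bridged hbr (G.dist u v)).2.2 hpos u v w hvw rfl heq.symm
  exact ⟨x, hvx, hwx, hx⟩
end

section
/- Let G be a hereditary modular graph with vertices ∗ and v such that the interval I(∗,v) is K_{2,3}-free. Then for every n ∈ ℕ the weight function f_{n,v} has finite support and ‖f_{n,v}‖₁ = Σ_w f_{n,v}(w) = (n+2)(n+1)/2. -/
/-- A connected graph is modular if every triple of vertices has a median. -/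
def Modular {W : Type*} (G : SimpleGraph W) : Prop :=
  G.Connected ∧ ∀ u v w : W, ∃ m : W,
    G.dist u m + G.dist m v = G.dist u v ∧
    G.dist u m + G.dist m w = G.dist u w ∧
    G.dist v m + G.dist m w = G.dist v w

/-- A connected graph is hereditary modular if every connected isometric subgraph
of it is modular. -/
def HereditaryModular {V : Type*} (G : SimpleGraph V) : Prop :=
  G.Connected ∧ ∀ H : G.Subgraph, H.Connected →
    (∀ x y : H.verts, H.coe.dist x y = G.dist x.1 y.1) → Modular H.coe

/-- The interval `I(u,v)`: the set of vertices lying on geodesics from `u` to `v`. -/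
def interval {V : Type*} (G : SimpleGraph V) (u v : V) : Set V :=
  {w | G.dist u w + G.dist w v = G.dist u v}

/-- A graph is `K_{2,3}`-free if there are no five distinct vertices
`a₀, a₁, b₀, b₁, b₂` with `aᵢ` adjacent to `bⱼ` for all `i`, `j`. -/
def K23Free {W : Type*} (G : SimpleGraph W) : Prop :=
  ¬ ∃ a₀ a₁ b₀ b₁ b₂ : W, a₀ ≠ a₁ ∧ b₀ ≠ b₁ ∧ b₀ ≠ b₂ ∧ b₁ ≠ b₂ ∧
    G.Adj a₀ b₀ ∧ G.Adj a₀ b₁ ∧ G.Adj a₀ b₂ ∧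
    G.Adj a₁ b₀ ∧ G.Adj a₁ b₁ ∧ G.Adj a₁ b₂

/-- `rho G b v w` is the number of vertices `x ∈ I(b,v)` adjacent to `w` with
`d(b,x) = d(b,w) - 1`. -/
noncomputable def rho {V : Type*} (G : SimpleGraph V) (b v w : V) : ℕ :=
  {x | x ∈ interval G b v ∧ G.Adj w x ∧ G.dist b x + 1 = G.dist b w}.ncard

open Classical in
/-- The weight function of Brodzki–Campbell–Guentner–Niblo–Wright. -/
noncomputable def weight {V : Type*} (G : SimpleGraph V) (b v : V) (n : ℕ) (w : V) : ℕ :=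
  if w ∉ interval G b v ∨ n < G.dist w v then 0
  else if 2 ≤ rho G b v w then 1
  else if rho G b v w = 1 then n - G.dist w v + 1
  else (n - G.dist w v + 2) * (n - G.dist w v + 1) / 2

section IntervalGeometry

variable {V : Type*} {G : SimpleGraph V}

theorem interval_comm (G : SimpleGraph V) (u v : V) : interval G u v = interval G v u := by
  ext w
  simp only [interval, Set.mem_ofPred_eq, G.dist_comm (u := v), G.dist_comm (v := u), add_comm]

/-- A vertex set that is closed under taking first steps of some geodesics induces an isometric
subgraph, so it is closed under some choice of medians. -/
theorem HereditaryModular.exists_median_mem (hG : HereditaryModular G) {s : Set V}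
    (hs : ∀ x ∈ s, ∀ y ∈ s, x ≠ y → ∃ z ∈ s, G.Adj x z ∧ G.dist z y + 1 = G.dist x y)
    {u v w : V} (hu : u ∈ s) (hv : v ∈ s) (hw : w ∈ s) :
    ∃ m ∈ s, G.dist u m + G.dist m v = G.dist u v ∧
      G.dist u m + G.dist m w = G.dist u w ∧ G.dist v m + G.dist m w = G.dist v w := by
  let H : G.Subgraph := (⊤ : G.Subgraph).induce s
  have hwalk : ∀ k, ∀ x y : H.verts, G.dist x.1 y.1 = k →
      ∃ p : H.coe.Walk x y, p.length = k := by
    intro k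
    induction k with
    | zero =>
      intro x y h
      obtain rfl : x = y := Subtype.ext (hG.1.dist_eq_zero_iff.mp h)
      exact ⟨.nil, rfl⟩
    | succ k ih =>
      intro x y h
      have hne : x.1 ≠ y.1 := fun e => by rw [e, SimpleGraph.dist_self] at h; omega
      obtain ⟨z, hz, hxz, hd⟩ := hs x.1 x.2 y.1 y.2 hne
      obtain ⟨p, hp⟩ := ih ⟨z, hz⟩ y (by simp only; omega)
      have hadj : H.coe.Adj x ⟨z, hz⟩ := by
        simpa [H] using! ⟨x.2, hz, hxz⟩
      exact ⟨.cons hadj p, by simp [hp]⟩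
  have hconn : H.coe.Connected :=
    { preconnected := fun x y => (hwalk _ x y rfl).choose.reachable
      nonempty := ⟨⟨u, hu⟩⟩ }
  have hiso : ∀ x y : H.verts, H.coe.dist x y = G.dist x.1 y.1 := by
    intro x y
    apply le_antisymm
    · obtain ⟨p, hp⟩ := hwalk _ x y rfl
      exact hp ▸ SimpleGraph.dist_le p
    · obtain ⟨p, hp⟩ := hconn.exists_walk_length_eq_dist x y
      rw [← hp, ← SimpleGraph.Walk.length_map H.hom p]
      exact SimpleGraph.dist_le _
  obtain ⟨m, h₁, h₂, h₃⟩ := (hG.2 H ⟨hconn⟩ hiso).2 ⟨u, hu⟩ ⟨v, hv⟩ ⟨w, hw⟩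
  simp only [hiso] at h₁ h₂ h₃
  exact ⟨m.1, m.2, h₁, h₂, h₃⟩

theorem SimpleGraph.Connected.exists_adj_dist_add_one (hG : G.Connected) {x y : V} (h : x ≠ y) :
    ∃ z, G.Adj x z ∧ G.dist z y + 1 = G.dist x y := by
  obtain ⟨p, hp⟩ := hG.exists_walk_length_eq_dist x y
  cases p with
  | nil => exact absurd rfl h
  | @cons _ z _ hxz q =>
    refine ⟨z, hxz, ?_⟩
    have h₁ := SimpleGraph.dist_le q
    have h₂ := hG.dist_triangle (u := x) (v := z) (w := y)
    rw [SimpleGraph.dist_eq_one_iff_adj.mpr hxz] at h₂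
    rw [SimpleGraph.Walk.length_cons] at hp
    omega

theorem HereditaryModular.modular (hG : HereditaryModular G) : Modular G := by
  refine ⟨hG.1, fun u v w => ?_⟩
  obtain ⟨m, -, hm⟩ := hG.exists_median_mem (s := Set.univ) (u := u) (v := v) (w := w)
    (fun x _ y _ hxy => by simpa using hG.1.exists_adj_dist_add_one hxy) trivial trivial trivial
  exact ⟨m, hm⟩

theorem Modular.dist_ne_of_adj (hG : Modular G) {p q : V} (hpq : G.Adj p q) (c : V) :
    G.dist c p ≠ G.dist c q := by
  intro h
  obtain ⟨m, h₁, h₂, h₃⟩ := hG.2 c p q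
  have := SimpleGraph.dist_eq_one_iff_adj.mpr hpq
  have := G.dist_comm (u := m) (v := p)
  omega

/-- Two vertices at equal distance from `b` with a common neighbour have a common neighbour
one step closer to `b`. -/
theorem Modular.exists_common_adj (hG : Modular G) {b w x₁ x₂ : V} (hne : x₁ ≠ x₂)
    (h₁ : G.Adj w x₁) (h₂ : G.Adj w x₂) (hd : G.dist b x₁ = G.dist b x₂) :
    ∃ y, G.Adj x₁ y ∧ G.Adj x₂ y ∧ G.dist b y + 1 = G.dist b x₁ := by
  obtain ⟨m, k₁, k₂, k₃⟩ := hG.2 x₁ x₂ b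
  have hnadj : ¬ G.Adj x₁ x₂ := fun h => hG.dist_ne_of_adj h b hd
  have hlt := hG.1.one_lt_dist_of_ne_of_not_adj hne hnadj
  have htri := hG.1.dist_triangle (u := x₁) (v := w) (w := x₂)
  rw [SimpleGraph.dist_eq_one_iff_adj.mpr h₁.symm, SimpleGraph.dist_eq_one_iff_adj.mpr h₂] at htri
  have c₁ := G.dist_comm (u := x₁) (v := b)
  have c₂ := G.dist_comm (u := x₂) (v := b)
  have c₃ := G.dist_comm (u := m) (v := b)
  have c₄ := G.dist_comm (u := m) (v := x₂)
  exact ⟨m, SimpleGraph.dist_eq_one_iff_adj.mp (by omega),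
    SimpleGraph.dist_eq_one_iff_adj.mp (by omega), by omega⟩

/-- A hereditary modular graph has no isometric hexagon. -/
theorem HereditaryModular.adj_of_hexagon (hG : HereditaryModular G) {x₁ x₂ x₃ y₁ y₂ y₃ : V}
    (hx₁₂ : G.dist x₁ x₂ = 2) (hx₁₃ : G.dist x₁ x₃ = 2) (hx₂₃ : G.dist x₂ x₃ = 2)
    (hy₁₂ : G.dist y₁ y₂ = 2) (hy₁₃ : G.dist y₁ y₃ = 2) (hy₂₃ : G.dist y₂ y₃ = 2)
    (h₁₂ : G.Adj x₁ y₂) (h₁₃ : G.Adj x₁ y₃) (h₂₁ : G.Adj x₂ y₁) (h₂₃ : G.Adj x₂ y₃)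
    (h₃₁ : G.Adj x₃ y₁) (h₃₂ : G.Adj x₃ y₂) :
    G.Adj x₁ y₁ ∨ G.Adj x₂ y₂ ∨ G.Adj x₃ y₃ := by
  by_contra! hcon
  have opposite : ∀ {x x' y : V}, G.dist x x' = 2 → G.Adj x' y → ¬ G.Adj x y →
      G.dist x y = 3 := by
    intro x x' y hxx' hadj hn
    have hM := hG.modular
    have h₁ := hM.dist_ne_of_adj hadj x
    have h₂ : G.dist x y ≠ 1 := fun h => hn (SimpleGraph.dist_eq_one_iff_adj.mp h)
    have h₃ := hadj.diff_dist_adj (u := x)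
    omega
  have d₁ := opposite hx₁₂ h₂₁ hcon.1
  have d₂ := opposite hx₂₃ h₃₂ hcon.2.1
  have d₃ := opposite ((G.dist_comm).trans hx₁₃) h₁₃ hcon.2.2
  have e₁₂ := SimpleGraph.dist_eq_one_iff_adj.mpr h₁₂
  have e₁₃ := SimpleGraph.dist_eq_one_iff_adj.mpr h₁₃
  have e₂₁ := SimpleGraph.dist_eq_one_iff_adj.mpr h₂₁
  have e₂₃ := SimpleGraph.dist_eq_one_iff_adj.mpr h₂₃
  have e₃₁ := SimpleGraph.dist_eq_one_iff_adj.mpr h₃₁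
  have e₃₂ := SimpleGraph.dist_eq_one_iff_adj.mpr h₃₂
  have hcomm : ∀ x y, G.dist x y = G.dist y x := fun _ _ => G.dist_comm
  have hadj : ∀ x y, G.Adj x y → G.Adj y x := fun _ _ h => h.symm
  have hself : ∀ x, G.dist x x = 0 := fun _ => G.dist_self
  clear opposite
  obtain ⟨m, hm, k₁, k₂, k₃⟩ := hG.exists_median_mem (s := {x₁, x₂, x₃, y₁, y₂, y₃})
    (u := x₁) (v := x₂) (w := x₃)
    (by
      simp only [Set.mem_insert_iff, Set.mem_singleton_iff, exists_eq_or_imp, exists_eq_left]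
      rintro x (rfl | rfl | rfl | rfl | rfl | rfl) y (rfl | rfl | rfl | rfl | rfl | rfl) hne <;>
        grind)
    (by simp) (by simp) (by simp)
  simp only [Set.mem_insert_iff, Set.mem_singleton_iff] at hm
  grind

/-- The neighbours of `w` in the interval `I(b,v)` that are one step closer to `b`. -/
def lowerNeighbors (G : SimpleGraph V) (b v w : V) : Set V :=
  {x | x ∈ interval G b v ∧ G.Adj w x ∧ G.dist b x + 1 = G.dist b w}

theorem rho_eq_ncard (G : SimpleGraph V) (b v w : V) :
    rho G b v w = (lowerNeighbors G b v w).ncard := rfl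

variable {b v w : V}

theorem dist_add_dist_of_mem_interval (hw : w ∈ interval G b v) :
    G.dist b w + G.dist w v = G.dist b v := hw

theorem mem_lowerNeighbors_swap {x : V} (hw : w ∈ interval G b v)
    (hx : x ∈ lowerNeighbors G b v w) : w ∈ lowerNeighbors G v b x := by
  obtain ⟨hxI, hadj, hd⟩ := hx
  refine ⟨interval_comm G b v ▸ hw, hadj.symm, ?_⟩
  have h₁ := dist_add_dist_of_mem_interval hw
  have h₂ := dist_add_dist_of_mem_interval hxI
  have h₃ := G.dist_comm (u := v) (v := w)
  have h₄ := G.dist_comm (u := v) (v := x)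
  omega

theorem mem_lowerNeighbors_of_adj (hG : G.Connected) {x : V} (hw : w ∈ interval G b v)
    (hadj : G.Adj w x) (hd : G.dist b x + 1 = G.dist b w) : x ∈ lowerNeighbors G b v w := by
  refine ⟨?_, hadj, hd⟩
  have h₁ := dist_add_dist_of_mem_interval hw
  have h₂ := hG.dist_triangle (u := x) (v := w) (w := v)
  have h₃ := hG.dist_triangle (u := b) (v := x) (w := v)
  rw [SimpleGraph.dist_eq_one_iff_adj.mpr hadj.symm] at h₂
  change _ = _
  omega

theorem lowerNeighbors_nonempty (hG : G.Connected) (hw : w ∈ interval G b v) (hne : w ≠ b) :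
    (lowerNeighbors G b v w).Nonempty := by
  obtain ⟨x, hadj, hd⟩ := hG.exists_adj_dist_add_one hne
  rw [G.dist_comm, G.dist_comm (u := w)] at hd
  exact ⟨x, mem_lowerNeighbors_of_adj hG hw hadj hd⟩

theorem Modular.exists_common_lowerNeighbor (hG : Modular G) {x₁ x₂ : V} (hne : x₁ ≠ x₂)
    (h₁ : x₁ ∈ lowerNeighbors G b v w) (h₂ : x₂ ∈ lowerNeighbors G b v w) :
    ∃ y, y ∈ lowerNeighbors G b v x₁ ∧ y ∈ lowerNeighbors G b v x₂ := by
  have hd : G.dist b x₁ = G.dist b x₂ := by have := h₁.2.2; have := h₂.2.2; omega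
  obtain ⟨y, hy₁, hy₂, hy⟩ := hG.exists_common_adj hne h₁.2.1 h₂.2.1 hd
  exact ⟨y, mem_lowerNeighbors_of_adj hG.1 h₁.1 hy₁ hy,
    mem_lowerNeighbors_of_adj hG.1 h₂.1 hy₂ (hd ▸ hy)⟩

theorem K23Free.false_of_adj {s : Set V} (h : K23Free (G.induce s)) {x₁ x₂ y₁ y₂ y₃ : V}
    (hx₁ : x₁ ∈ s) (hx₂ : x₂ ∈ s) (hy₁ : y₁ ∈ s) (hy₂ : y₂ ∈ s) (hy₃ : y₃ ∈ s)
    (hx : x₁ ≠ x₂) (h₁₂ : y₁ ≠ y₂) (h₁₃ : y₁ ≠ y₃) (h₂₃ : y₂ ≠ y₃)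
    (a₁ : G.Adj x₁ y₁) (a₂ : G.Adj x₁ y₂) (a₃ : G.Adj x₁ y₃)
    (b₁ : G.Adj x₂ y₁) (b₂ : G.Adj x₂ y₂) (b₃ : G.Adj x₂ y₃) : False :=
  h ⟨⟨x₁, hx₁⟩, ⟨x₂, hx₂⟩, ⟨y₁, hy₁⟩, ⟨y₂, hy₂⟩, ⟨y₃, hy₃⟩, by simpa using hx,
    by simpa using h₁₂, by simpa using h₁₃, by simpa using h₂₃, a₁, a₂, a₃, b₁, b₂, b₃⟩

theorem Modular.dist_eq_two (hG : Modular G) {x₁ x₂ : V} (hne : x₁ ≠ x₂)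
    (h₁ : x₁ ∈ lowerNeighbors G b v w) (h₂ : x₂ ∈ lowerNeighbors G b v w) :
    G.dist x₁ x₂ = 2 := by
  have hnadj : ¬ G.Adj x₁ x₂ := fun h => hG.dist_ne_of_adj h b (by
    have := h₁.2.2; have := h₂.2.2; omega)
  have hlt := hG.1.one_lt_dist_of_ne_of_not_adj hne hnadj
  have htri := hG.1.dist_triangle (u := x₁) (v := w) (w := x₂)
  rw [SimpleGraph.dist_eq_one_iff_adj.mpr h₁.2.1.symm,
    SimpleGraph.dist_eq_one_iff_adj.mpr h₂.2.1] at htri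
  omega

theorem HereditaryModular.not_three_lowerNeighbors (hG : HereditaryModular G)
    (hflat : K23Free (G.induce (interval G b v))) (hw : w ∈ interval G b v) {x₁ x₂ x₃ : V}
    (h₁₂ : x₁ ≠ x₂) (h₁₃ : x₁ ≠ x₃) (h₂₃ : x₂ ≠ x₃) (h₁ : x₁ ∈ lowerNeighbors G b v w)
    (h₂ : x₂ ∈ lowerNeighbors G b v w) (h₃ : x₃ ∈ lowerNeighbors G b v w) : False := by
  have hM := hG.modular
  obtain ⟨y₃, p₁₃, p₂₃⟩ := hM.exists_common_lowerNeighbor h₁₂ h₁ h₂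
  obtain ⟨y₂, p₁₂, p₃₂⟩ := hM.exists_common_lowerNeighbor h₁₃ h₁ h₃
  obtain ⟨y₁, p₂₁, p₃₁⟩ := hM.exists_common_lowerNeighbor h₂₃ h₂ h₃
  have key : ∀ y ∈ interval G b v, G.dist b y + 2 = G.dist b w → G.Adj x₁ y → G.Adj x₂ y →
      G.Adj x₃ y → False := fun y hy hd a₁ a₂ a₃ =>
    hflat.false_of_adj hw hy h₁.1 h₂.1 h₃.1 (by rintro rfl; omega) h₁₂ h₁₃ h₂₃
      h₁.2.1 h₂.2.1 h₃.2.1 a₁.symm a₂.symm a₃.symm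
  have d₁ := h₁.2.2
  have d₂ := h₂.2.2
  have e₁ := p₂₁.2.2
  have e₂ := p₁₂.2.2
  have e₃ := p₁₃.2.2
  have hy₁₂ : y₁ ≠ y₂ := by
    rintro rfl
    exact key y₁ p₂₁.1 (by omega) p₁₂.2.1 p₂₁.2.1 p₃₁.2.1
  have hy₁₃ : y₁ ≠ y₃ := by
    rintro rfl
    exact key y₁ p₂₁.1 (by omega) p₁₃.2.1 p₂₁.2.1 p₃₁.2.1
  have hy₂₃ : y₂ ≠ y₃ := by
    rintro rfl
    exact key y₂ p₁₂.1 (by omega) p₁₂.2.1 p₂₃.2.1 p₃₂.2.1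
  rcases hG.adj_of_hexagon (hM.dist_eq_two h₁₂ h₁ h₂) (hM.dist_eq_two h₁₃ h₁ h₃)
    (hM.dist_eq_two h₂₃ h₂ h₃) (hM.dist_eq_two hy₁₂ p₃₁ p₃₂) (hM.dist_eq_two hy₁₃ p₂₁ p₂₃)
    (hM.dist_eq_two hy₂₃ p₁₂ p₁₃) p₁₂.2.1 p₁₃.2.1 p₂₁.2.1 p₂₃.2.1 p₃₁.2.1 p₃₂.2.1 with h | h | h
  · exact key y₁ p₂₁.1 (by omega) h p₂₁.2.1 p₃₁.2.1
  · exact key y₂ p₁₂.1 (by omega) p₁₂.2.1 h p₃₂.2.1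
  · exact key y₃ p₁₃.1 (by omega) p₁₃.2.1 p₂₃.2.1 h

theorem HereditaryModular.encard_lowerNeighbors_le (hG : HereditaryModular G)
    (hflat : K23Free (G.induce (interval G b v))) (hw : w ∈ interval G b v) :
    (lowerNeighbors G b v w).encard ≤ 2 := by
  by_contra! h
  obtain ⟨t, ht, hcard⟩ := Set.exists_subset_encard_eq (Order.add_one_le_of_lt h)
  obtain ⟨x₁, x₂, x₃, h₁₂, h₁₃, h₂₃, rfl⟩ := Set.encard_eq_three.mp (hcard.trans (by norm_num))
  exact hG.not_three_lowerNeighbors hflat hw h₁₂ h₁₃ h₂₃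
    (ht (by simp)) (ht (by simp)) (ht (by simp))

theorem HereditaryModular.finite_lowerNeighbors (hG : HereditaryModular G)
    (hflat : K23Free (G.induce (interval G b v))) (hw : w ∈ interval G b v) :
    (lowerNeighbors G b v w).Finite :=
  Set.finite_of_encard_le_coe (k := 2) (hG.encard_lowerNeighbors_le hflat hw)

theorem HereditaryModular.rho_le_two (hG : HereditaryModular G)
    (hflat : K23Free (G.induce (interval G b v))) (hw : w ∈ interval G b v) :
    rho G b v w ≤ 2 := by
  have h := hG.encard_lowerNeighbors_le hflat hw
  rw [← (hG.finite_lowerNeighbors hflat hw).cast_ncard_eq] at h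
  exact_mod_cast h

theorem HereditaryModular.rho_pos (hG : HereditaryModular G)
    (hflat : K23Free (G.induce (interval G b v))) (hw : w ∈ interval G b v) (hne : w ≠ b) :
    0 < rho G b v w :=
  (Set.ncard_pos (hG.finite_lowerNeighbors hflat hw)).mpr (lowerNeighbors_nonempty hG.1 hw hne)

theorem rho_self (G : SimpleGraph V) (b v : V) : rho G b v b = 0 := by
  have h : lowerNeighbors G b v b = ∅ := by
    ext x
    simp [lowerNeighbors]
  rw [rho_eq_ncard, h, Set.ncard_empty]

theorem HereditaryModular.finite_interval (hG : HereditaryModular G)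
    (hflat : K23Free (G.induce (interval G b v))) : (interval G b v).Finite := by
  have hlevel : ∀ k, {w | w ∈ interval G b v ∧ G.dist w v = k}.Finite := by
    intro k
    induction k with
    | zero =>
      refine (Set.finite_singleton v).subset fun w hw => ?_
      exact hG.1.dist_eq_zero_iff.mp hw.2
    | succ k ih =>
      refine (ih.biUnion fun w hw => hG.finite_lowerNeighbors hflat hw.1).subset fun x hx => ?_
      have hne : x ≠ v := by
        rintro rfl
        simpa using hx.2
      obtain ⟨w, hw⟩ := lowerNeighbors_nonempty hG.1 (interval_comm G b v ▸ hx.1) hne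
      have hd := hw.2.2
      rw [G.dist_comm, G.dist_comm (u := v), hx.2] at hd
      have hxw := mem_lowerNeighbors_swap (interval_comm G b v ▸ hx.1) hw
      exact Set.mem_biUnion (x := w) ⟨interval_comm G b v ▸ hw.1, by omega⟩ hxw
  refine ((Set.finite_Iic (G.dist b v)).biUnion fun k _ => hlevel k).subset fun w hw => ?_
  have := dist_add_dist_of_mem_interval hw
  exact Set.mem_biUnion (x := G.dist w v) (Set.mem_Iic.mpr (by omega)) ⟨hw, rfl⟩

/-- `z` and `y` are opposite corners of a square of `I(b,v)`, with `y` closer to `b`. -/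
def SpansSquare (G : SimpleGraph V) (b v z y : V) : Prop :=
  ∃ x₁ x₂, x₁ ≠ x₂ ∧ x₁ ∈ lowerNeighbors G b v z ∧ x₂ ∈ lowerNeighbors G b v z ∧
    y ∈ lowerNeighbors G b v x₁ ∧ y ∈ lowerNeighbors G b v x₂

theorem HereditaryModular.spansSquare_left_unique (hG : HereditaryModular G)
    (hflat : K23Free (G.induce (interval G b v))) {z z' y : V} (hz : z ∈ interval G b v)
    (hz' : z' ∈ interval G b v) (h : SpansSquare G b v z y) (h' : SpansSquare G b v z' y) :
    z = z' := by
  obtain ⟨x₁, x₂, hne, p₁, p₂, q₁, q₂⟩ := h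
  obtain ⟨x₁', x₂', hne', p₁', p₂', q₁', q₂'⟩ := h'
  have hflat' : K23Free (G.induce (interval G v b)) := interval_comm G b v ▸ hflat
  have hyI : y ∈ interval G v b := interval_comm G b v ▸ q₁.1
  have u₁ := mem_lowerNeighbors_swap p₁.1 q₁
  have u₂ := mem_lowerNeighbors_swap p₂.1 q₂
  have u₁' := mem_lowerNeighbors_swap p₁'.1 q₁'
  have u₂' := mem_lowerNeighbors_swap p₂'.1 q₂'
  have no_third : ∀ x ∈ lowerNeighbors G v b y, x = x₁ ∨ x = x₂ := by
    intro x hx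
    by_contra! hcon
    exact hG.not_three_lowerNeighbors hflat' hyI hne hcon.1.symm hcon.2.symm u₁ u₂ hx
  have ha : G.Adj z' x₁ ∧ G.Adj z' x₂ := by
    have a₁ := p₁'.2.1
    have a₂ := p₂'.2.1
    rcases no_third x₁' u₁' with rfl | rfl <;> rcases no_third x₂' u₂' with rfl | rfl
    · exact absurd rfl hne'
    · exact ⟨a₁, a₂⟩
    · exact ⟨a₂, a₁⟩
    · exact absurd rfl hne'
  by_contra hzz
  have d₁ := p₁.2.2
  have d₂ := q₁.2.2
  have d₁' := p₁'.2.2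
  have d₂' := q₁'.2.2
  exact hflat.false_of_adj p₁.1 p₂.1 hz hz' q₁.1 hne hzz (by rintro rfl; omega)
    (by rintro rfl; omega) p₁.2.1.symm ha.1.symm q₁.2.1 p₂.2.1.symm ha.2.symm q₂.2.1

theorem HereditaryModular.exists_spansSquare (hG : HereditaryModular G)
    (hflat : K23Free (G.induce (interval G b v))) {z : V} (hρ : rho G b v z = 2) :
    ∃ y ∈ interval G b v, G.dist b y + 2 = G.dist b z ∧ rho G v b y = 2 ∧
      SpansSquare G b v z y := by
  obtain ⟨x₁, x₂, hne, hS⟩ := Set.ncard_eq_two.mp hρ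
  have p₁ : x₁ ∈ lowerNeighbors G b v z := (Set.ext_iff.mp hS x₁).mpr (by simp)
  have p₂ : x₂ ∈ lowerNeighbors G b v z := (Set.ext_iff.mp hS x₂).mpr (by simp)
  obtain ⟨y, q₁, q₂⟩ := hG.modular.exists_common_lowerNeighbor hne p₁ p₂
  have hflat' : K23Free (G.induce (interval G v b)) := interval_comm G b v ▸ hflat
  have hyI : y ∈ interval G v b := interval_comm G b v ▸ q₁.1
  refine ⟨y, q₁.1, by have := p₁.2.2; have := q₁.2.2; omega, ?_, x₁, x₂, hne, p₁, p₂, q₁, q₂⟩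
  refine le_antisymm (hG.rho_le_two hflat' hyI) ?_
  have hsub : ({x₁, x₂} : Set V) ⊆ lowerNeighbors G v b y := by
    rintro x (rfl | rfl)
    exacts [mem_lowerNeighbors_swap p₁.1 q₁, mem_lowerNeighbors_swap p₂.1 q₂]
  have := Set.ncard_le_ncard hsub (hG.finite_lowerNeighbors hflat' hyI)
  rwa [Set.ncard_pair hne] at this

open Finset

theorem HereditaryModular.card_rho_eq_two_le (hG : HereditaryModular G)
    (hflat : K23Free (G.induce (interval G b v))) {F : Finset V}
    (hF : ∀ w, w ∈ F ↔ w ∈ interval G b v) (k : ℕ) :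
    #{z ∈ F | G.dist z v = k ∧ rho G b v z = 2} ≤
      #{y ∈ F | G.dist y v = k + 2 ∧ rho G v b y = 2} := by
  refine card_le_card_of_forall_subsingleton (SpansSquare G b v) ?_ ?_
  · intro z hz
    obtain ⟨hzF, hzk, hρ⟩ := mem_filter.mp hz
    obtain ⟨y, hy, hd, hρy, hsq⟩ := hG.exists_spansSquare hflat hρ
    have h₁ := dist_add_dist_of_mem_interval hy
    have h₂ := dist_add_dist_of_mem_interval ((hF z).mp hzF)
    exact ⟨y, mem_filter.mpr ⟨(hF y).mpr hy, by omega, hρy⟩, hsq⟩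
  · rintro y - z ⟨hz, hzy⟩ z' ⟨hz', hzy'⟩
    exact hG.spansSquare_left_unique hflat ((hF z).mp (mem_filter.mp hz).1)
      ((hF z').mp (mem_filter.mp hz').1) hzy hzy'

theorem HereditaryModular.card_rho_eq_two (hG : HereditaryModular G)
    (hflat : K23Free (G.induce (interval G b v))) {F : Finset V}
    (hF : ∀ w, w ∈ F ↔ w ∈ interval G b v) {k : ℕ} (hk : k + 2 ≤ G.dist b v) :
    #{z ∈ F | G.dist z v = k ∧ rho G b v z = 2} =
      #{y ∈ F | G.dist y v = k + 2 ∧ rho G v b y = 2} := by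
  refine le_antisymm (hG.card_rho_eq_two_le hflat hF k) ?_
  obtain ⟨j, hj⟩ := Nat.exists_eq_add_of_le hk
  have h := hG.card_rho_eq_two_le (interval_comm G b v ▸ hflat) (F := F)
    (fun w => interval_comm G b v ▸ hF w) j
  have hdist : ∀ w ∈ F, G.dist w b + G.dist w v = k + 2 + j := fun w hw => by
    rw [G.dist_comm (u := w) (v := b), ← hj]
    exact (hF w).mp hw
  have hlower : {y ∈ F | G.dist y v = k + 2 ∧ rho G v b y = 2} =
      {y ∈ F | G.dist y b = j ∧ rho G v b y = 2} :=
    filter_congr fun w hw => and_congr_left' (by have := hdist w hw; omega)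
  have hupper : {z ∈ F | G.dist z v = k ∧ rho G b v z = 2} =
      {z ∈ F | G.dist z b = j + 2 ∧ rho G b v z = 2} :=
    filter_congr fun w hw => and_congr_left' (by have := hdist w hw; omega)
  rw [hlower, hupper]
  exact h

/-- Both sides count the edges between two consecutive levels of the interval. -/
theorem sum_rho_level {F : Finset V}
    (hF : ∀ w, w ∈ F ↔ w ∈ interval G b v) (k : ℕ) :
    ∑ w ∈ F with G.dist w v = k, rho G b v w =
      ∑ w ∈ F with G.dist w v = k + 1, rho G v b w := by
  classical
  convert sum_card_bipartiteAbove_eq_sum_card_bipartiteBelow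
    (s := {w ∈ F | G.dist w v = k}) (t := {w ∈ F | G.dist w v = k + 1}) G.Adj using 2 with w hw w hw
  · obtain ⟨hwF, hwk⟩ := mem_filter.mp hw
    rw [rho_eq_ncard, ← Set.ncard_coe_finset]
    congr 1
    ext x
    have h₁ := dist_add_dist_of_mem_interval ((hF w).mp hwF)
    simp only [lowerNeighbors, coe_bipartiteAbove, mem_filter, Set.mem_ofPred_eq, hF]
    constructor
    · rintro ⟨hx, hadj, hd⟩
      have h₂ := dist_add_dist_of_mem_interval hx
      exact ⟨⟨hx, by omega⟩, hadj⟩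
    · rintro ⟨⟨hx, hd⟩, hadj⟩
      have h₂ := dist_add_dist_of_mem_interval hx
      exact ⟨hx, hadj, by omega⟩
  · obtain ⟨hwF, hwk⟩ := mem_filter.mp hw
    rw [rho_eq_ncard, ← Set.ncard_coe_finset]
    congr 1
    ext x
    simp only [lowerNeighbors, coe_bipartiteBelow, mem_filter, Set.mem_ofPred_eq, hF,
      interval_comm G v b, G.dist_comm (u := v), hwk, Nat.add_right_cancel_iff, G.adj_comm w x]
    tauto

/-- Every vertex of a level away from `b` has one or two lower neighbours. -/
theorem HereditaryModular.sum_rho_eq (hG : HereditaryModular G)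
    (hflat : K23Free (G.induce (interval G b v))) {s : Finset V}
    (hs : ∀ w ∈ s, w ∈ interval G b v ∧ w ≠ b) :
    ∑ w ∈ s, rho G b v w = #s + #{w ∈ s | rho G b v w = 2} := by
  rw [card_eq_sum_ones, card_filter, ← sum_add_distrib]
  refine sum_congr rfl fun w hw => ?_
  have h₁ := hG.rho_le_two hflat (hs w hw).1
  have h₂ := hG.rho_pos hflat (hs w hw).1 (hs w hw).2
  split_ifs <;> omega

theorem level_zero (hG : G.Connected) {F : Finset V}
    (hF : ∀ w, w ∈ F ↔ w ∈ interval G b v) : {w ∈ F | G.dist w v = 0} = {v} := by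
  ext w
  simp only [mem_filter, mem_singleton, hF, hG.dist_eq_zero_iff]
  constructor
  · exact And.right
  · rintro rfl
    exact ⟨by simp [interval], rfl⟩

theorem HereditaryModular.card_level_succ (hG : HereditaryModular G)
    (hflat : K23Free (G.induce (interval G b v))) {F : Finset V}
    (hF : ∀ w, w ∈ F ↔ w ∈ interval G b v) {k : ℕ} (hk : k < G.dist b v) :
    #{w ∈ F | G.dist w v = k + 1} = #{w ∈ F | G.dist w v = k ∧ rho G b v w = 2} + 1 := by
  have hflat' : K23Free (G.induce (interval G v b)) := interval_comm G b v ▸ hflat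
  have edges : ∀ k < G.dist b v,
      #{w ∈ F | G.dist w v = k} + #{w ∈ F | G.dist w v = k ∧ rho G b v w = 2} =
        #{w ∈ F | G.dist w v = k + 1} + #{w ∈ F | G.dist w v = k + 1 ∧ rho G v b w = 2} := by
    intro k hk
    simp only [← filter_filter]
    rw [← hG.sum_rho_eq hflat, ← hG.sum_rho_eq hflat', sum_rho_level hF]
    · intro w hw
      obtain ⟨hwF, hwk⟩ := mem_filter.mp hw
      refine ⟨interval_comm G b v ▸ (hF w).mp hwF, ?_⟩
      rintro rfl
      simp at hwk
    · intro w hw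
      obtain ⟨hwF, hwk⟩ := mem_filter.mp hw
      refine ⟨(hF w).mp hwF, ?_⟩
      rintro rfl
      omega
  induction k with
  | zero =>
    have h₁ := edges 0 hk
    have h₄ := level_zero hG.1 hF
    have hzero : #{w ∈ F | G.dist w v = 0 + 1 ∧ rho G v b w = 2} = 0 := by
      rw [card_eq_zero, filter_eq_empty_iff]
      rintro w hw ⟨hwv, hρ⟩
      obtain ⟨x, y, hne, hS⟩ := Set.ncard_eq_two.mp hρ
      have eq_v : ∀ u ∈ lowerNeighbors G v b w, u = v := fun u hu => by
        have := hu.2.2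
        rw [G.dist_comm (u := v) (v := w), hwv] at this
        exact (hG.1.dist_eq_zero_iff.mp (by omega)).symm
      exact hne ((eq_v x ((Set.ext_iff.mp hS x).mpr (by simp))).trans
        (eq_v y ((Set.ext_iff.mp hS y).mpr (by simp))).symm)
    rw [h₄, card_singleton] at h₁
    omega
  | succ k ih =>
    have h₁ := edges (k + 1) hk
    rw [add_assoc k 1 1, one_add_one_eq_two] at h₁ ⊢
    have h₂ := ih (by omega)
    have h₃ := hG.card_rho_eq_two hflat hF (k := k) (by omega)
    omega

theorem weight_of_lt_dist {n : ℕ} (h : n < G.dist w v) : weight G b v n w = 0 := by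
  simp [weight, h]

theorem weight_self {n : ℕ} (h : G.dist b v ≤ n) :
    weight G b v n b = (n - G.dist b v + 2) * (n - G.dist b v + 1) / 2 := by
  simp [weight, rho_self, interval, h]

theorem HereditaryModular.sum_weight_level (hG : HereditaryModular G)
    (hflat : K23Free (G.induce (interval G b v))) {F : Finset V}
    (hF : ∀ w, w ∈ F ↔ w ∈ interval G b v) {k r : ℕ} (hk : k < G.dist b v) :
    ∑ w ∈ F with G.dist w v = k, weight G b v (k + r) w +
      r * #{w ∈ F | G.dist w v = k ∧ rho G b v w = 2} =
      (r + 1) * #{w ∈ F | G.dist w v = k} := by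
  rw [← filter_filter, card_filter, card_eq_sum_ones, mul_sum, mul_sum, ← sum_add_distrib]
  refine sum_congr rfl fun w hw => ?_
  obtain ⟨hwF, hwk⟩ := mem_filter.mp hw
  have hwI := (hF w).mp hwF
  have hne : w ≠ b := by
    rintro rfl
    omega
  have h₁ := hG.rho_le_two hflat hwI
  have h₂ := hG.rho_pos hflat hwI hne
  have hle : ¬ (w ∉ interval G b v ∨ k + r < G.dist w v) := by
    rintro (h | h)
    · exact h hwI
    · omega
  rw [weight, if_neg hle]
  obtain h | h : rho G b v w = 1 ∨ rho G b v w = 2 := by omega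
  · simp [h, hwk]
  · simp [h, add_comm]

theorem HereditaryModular.two_mul_sum_weight_range (hG : HereditaryModular G)
    (hflat : K23Free (G.induce (interval G b v))) {F : Finset V}
    (hF : ∀ w, w ∈ F ↔ w ∈ interval G b v) {n : ℕ} {k : ℕ} (hk : k ≤ G.dist b v) :
    ∀ r, k + r = n + 1 →
    2 * ∑ i ∈ range k, ∑ w ∈ F with G.dist w v = i, weight G b v n w +
      2 * r * #{w ∈ F | G.dist w v = k} + r * r = (n + 2) * (n + 1) + r := by
  induction k with
  | zero =>
    intro r hr
    obtain rfl : r = n + 1 := by omega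
    rw [level_zero hG.1 hF, card_singleton, sum_range_zero]
    ring
  | succ k ih =>
    intro r hr
    obtain rfl : n = k + r := by omega
    have h₁ := ih (by omega) (r + 1) (by omega)
    have h₂ := hG.sum_weight_level hflat hF (r := r) (k := k) (by omega)
    have h₃ := hG.card_level_succ hflat hF (k := k) (by omega)
    rw [sum_range_succ, h₃]
    nlinarith

end IntervalGeometry

/-- In a hereditary modular graph with a `K_{2,3}`-free interval `I(b,v)`, the weight
function `f_{n,v}` has finite support and `‖f_{n,v}‖₁ = (n+2)(n+1)/2`. -/
theorem weight_l1_norm {V : Type*} (G : SimpleGraph V)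
    (hG : HereditaryModular G) (b v : V)
    (hflat : K23Free (G.induce (interval G b v))) (n : ℕ) :
    (Function.support (weight G b v n)).Finite ∧
      ∑ᶠ w, weight G b v n w = (n + 2) * (n + 1) / 2 := by
  have hfin := hG.finite_interval hflat
  have hF : ∀ w, w ∈ hfin.toFinset ↔ w ∈ interval G b v := fun w => hfin.mem_toFinset
  have hsupp : Function.support (weight G b v n) ⊆ hfin.toFinset := by
    intro w hw
    by_contra h
    rw [Finset.mem_coe, hF] at h
    exact hw (by simp [weight, h])
  refine ⟨hfin.toFinset.finite_toSet.subset hsupp, ?_⟩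
  rw [finsum_eq_sum_of_support_subset _ hsupp]
  have hmaps : ∀ w ∈ hfin.toFinset, G.dist w v ∈ Finset.range (G.dist b v + 1) := fun w hw => by
    have := dist_add_dist_of_mem_interval ((hF w).mp hw)
    exact Finset.mem_range.mpr (by omega)
  rw [← Finset.sum_fiberwise_of_maps_to hmaps]
  rcases lt_or_ge n (G.dist b v) with hlt | hge
  · have hsub : Finset.range (n + 1) ⊆ Finset.range (G.dist b v + 1) :=
      Finset.range_subset_range.mpr (by omega)
    rw [← Finset.sum_subset hsub]
    · have := hG.two_mul_sum_weight_range hflat hF (n := n) (k := n + 1) hlt 0 rfl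
      omega
    · intro k _ hk
      refine Finset.sum_eq_zero fun w hw => weight_of_lt_dist ?_
      rw [(Finset.mem_filter.mp hw).2]
      simpa using hk
  · obtain ⟨r, rfl⟩ := Nat.exists_eq_add_of_le hge
    have htop : {w ∈ hfin.toFinset | G.dist w v = G.dist b v} = {b} := by
      ext w
      simp only [Finset.mem_filter, Finset.mem_singleton, hF]
      constructor
      · rintro ⟨hw, hd⟩
        have := dist_add_dist_of_mem_interval hw
        exact (hG.1.dist_eq_zero_iff.mp (by omega)).symm
      · rintro rfl
        exact ⟨by simp [interval], rfl⟩
    have h := hG.two_mul_sum_weight_range hflat hF (n := G.dist b v + r) le_rfl (r + 1) (by omega)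
    have heven : 2 ∣ (r + 2) * (r + 1) := by
      rw [mul_comm]
      exact (Nat.even_mul_succ_self (r + 1)).two_dvd
    rw [htop, Finset.card_singleton] at h
    rw [Finset.sum_range_succ, htop, Finset.sum_singleton, weight_self hge, Nat.add_sub_cancel_left]
    obtain ⟨c, hc⟩ := heven
    rw [hc, Nat.mul_div_cancel_left _ two_pos]
    refine (Nat.div_eq_of_eq_mul_right two_pos ?_).symm
    linarith
end
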